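/- arXiv:1506.02126 — 5 statements merged into one kernel-verified Lean document; each statement's English description precedes it below -/
import Mathlib

section
/- Let X be a Hilbert space, M a bounded Borel subset of ℝ^d, F : X → L¹(M) an operator, f† ∈ X with exact data g† := F(f†), and suppose the smoothing assumption holds with exponent q = 2 and D(f) := ‖f − f†‖²_X. Let f̂_α be a Tikhonov estimator with penalty R(f) = ‖f‖²_X and L¹ data fidelity. Then for all α > 0, all ε ≥ 0 and all 0 ≤ η ≤ δ₀/2 for which the noise model holds, one has ‖f̂_α‖_X ≤ ‖f†‖_X + √(2ε/α) + 2ηγ(2η)/α. -/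
open MeasureTheory

/-- Energy bound for the Tikhonov estimator with `L¹` data fidelity
under impulsive noise (Proposition 2.5, part 1). -/
theorem tikhonov_energy_bound
    {X : Type*} [NormedAddCommGroup X] [InnerProductSpace ℝ X] [CompleteSpace X]
    {d : ℕ} (M : Set (EuclideanSpace ℝ (Fin d)))
    (hMmeas : MeasurableSet M) (hMbdd : Bornology.IsBounded M)
    (F : X → EuclideanSpace ℝ (Fin d) → ℝ)
    (hFmeas : ∀ f : X, AEStronglyMeasurable (F f) (volume.restrict M))
    -- `F` maps into `L¹(M)`
    (hFL1 : ∀ f : X, eLpNorm (F f) 1 (volume.restrict M) ≠ ⊤)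
    (fdag : X)
    -- smoothing assumption with exponent `q = 2` and `D f = ‖f - f†‖²`
    (δ₀ : ℝ) (hδ₀ : 0 < δ₀) (γ : ℝ → ℝ)
    (hγnonneg : ∀ δ : ℝ, 0 < δ → δ ≤ δ₀ → 0 ≤ γ δ)
    (hγmono : ∀ δ₁ δ₂ : ℝ, 0 < δ₁ → δ₁ ≤ δ₂ → δ₂ ≤ δ₀ → γ δ₁ ≤ γ δ₂)
    (hγlim : Filter.Tendsto γ (nhdsWithin 0 (Set.Ioi 0)) (nhds 0))
    (hsmooth : ∀ f : X, ∀ δ : ℝ, 0 < δ → δ ≤ δ₀ →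
      eLpNorm (fun x => F f x - F fdag x) ⊤ (volume.restrict M)
        ≤ ENNReal.ofReal (γ δ * (‖f - fdag‖ ^ 2) ^ ((1 : ℝ) / 2))
          + ENNReal.ofReal (1 / δ) *
              eLpNorm (fun x => F f x - F fdag x) 1 (volume.restrict M))
    -- noise model
    (ξ : EuclideanSpace ℝ (Fin d) → ℝ)
    (hξmeas : AEStronglyMeasurable ξ (volume.restrict M))
    (hξL1 : eLpNorm ξ 1 (volume.restrict M) ≠ ⊤)
    (gobs : EuclideanSpace ℝ (Fin d) → ℝ)
    (hgobs : ∀ x, gobs x = F fdag x + ξ x)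
    (ε η : ℝ) (hε : 0 ≤ ε) (hη : 0 ≤ η) (hηδ₀ : η ≤ δ₀ / 2)
    (Mc : Set (EuclideanSpace ℝ (Fin d))) (hMcmeas : MeasurableSet Mc) (hMcM : Mc ⊆ M)
    (hnoise_out : eLpNorm ξ 1 (volume.restrict (M \ Mc)) ≤ ENNReal.ofReal ε)
    (hnoise_size : volume Mc ≤ ENNReal.ofReal η)
    -- Tikhonov estimator with penalty `R f = ‖f‖²`
    (α : ℝ) (hα : 0 < α) (fhat : X)
    (hfhat : ∀ f : X,
      ENNReal.ofReal (1 / α) * eLpNorm (fun x => F fhat x - gobs x) 1 (volume.restrict M)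
          + ENNReal.ofReal (‖fhat‖ ^ 2)
        ≤ ENNReal.ofReal (1 / α) * eLpNorm (fun x => F f x - gobs x) 1 (volume.restrict M)
          + ENNReal.ofReal (‖f‖ ^ 2)) :
    ‖fhat‖ ≤ ‖fdag‖ + Real.sqrt (2 * ε / α) + 2 * η * γ (2 * η) / α := by
  have key : ∀ (u : EuclideanSpace ℝ (Fin d) → ℝ) (S : Set (EuclideanSpace ℝ (Fin d))),
      IntegrableOn u S volume →
      eLpNorm u 1 (volume.restrict S) = ENNReal.ofReal (∫ x in S, ‖u x‖) := by
    intro u S hu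
    rw [eLpNorm_one_eq_lintegral_enorm, ofReal_integral_norm_eq_lintegral_enorm hu]
  have hFi : ∀ f, IntegrableOn (F f) M volume := fun f =>
    memLp_one_iff_integrable.1 ⟨hFmeas f, (hFL1 f).lt_top⟩
  have hξi : IntegrableOn ξ M volume :=
    memLp_one_iff_integrable.1 ⟨hξmeas, hξL1.lt_top⟩
  obtain ⟨h, hh⟩ : ∃ h : EuclideanSpace ℝ (Fin d) → ℝ, h = fun x => F fhat x - F fdag x :=
    ⟨_, rfl⟩
  have hhi : IntegrableOn h M volume := by
    rw [hh]; exact (hFi fhat).sub (hFi fdag)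
  have hhξ : IntegrableOn (fun x => h x - ξ x) M volume := hhi.sub hξi
  have e1 : (fun x => F fhat x - gobs x) = fun x => h x - ξ x := by
    funext x; rw [hgobs, hh]; ring
  have e2 : (fun x => F fdag x - gobs x) = fun x => - ξ x := by
    funext x; rw [hgobs]; ring
  have hmin := hfhat fdag
  rw [e1, e2, key _ _ hhξ, key (fun x => - ξ x) M hξi.neg, ← ENNReal.ofReal_mul (by positivity),
    ← ENNReal.ofReal_mul (by positivity), ← ENNReal.ofReal_add (by positivity) (by positivity),
    ← ENNReal.ofReal_add (by positivity) (by positivity),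
    ENNReal.ofReal_le_ofReal_iff (by positivity)] at hmin
  simp only [norm_neg] at hmin
  have hsub : M \ Mc ⊆ M := Set.diff_subset
  have hout : (∫ x in M \ Mc, ‖ξ x‖) ≤ ε := by
    rw [key _ _ (hξi.mono_set hsub)] at hnoise_out
    exact (ENNReal.ofReal_le_ofReal_iff hε).1 hnoise_out
  have split : ∀ u : EuclideanSpace ℝ (Fin d) → ℝ, IntegrableOn u M volume →
      (∫ x in M, ‖u x‖) = (∫ x in Mc, ‖u x‖) + ∫ x in M \ Mc, ‖u x‖ := by
    intro u hu
    have := integral_inter_add_diff (μ := volume) (s := M) (f := fun x => ‖u x‖) hMcmeas hu.norm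
    rw [Set.inter_eq_self_of_subset_right hMcM] at this
    exact this.symm
  have i1 : (∫ x in Mc, ‖ξ x‖) ≤ (∫ x in Mc, ‖h x - ξ x‖) + ∫ x in Mc, ‖h x‖ := by
    rw [← integral_add (hhξ.mono_set hMcM).norm (hhi.mono_set hMcM).norm]
    refine integral_mono (hξi.mono_set hMcM).norm
      ((hhξ.mono_set hMcM).norm.add (hhi.mono_set hMcM).norm) fun x => ?_
    have := norm_sub_norm_le (ξ x) (h x)
    rw [norm_sub_rev] at this
    simp only
    linarith
  have i2 : (∫ x in M \ Mc, ‖h x‖) ≤ (∫ x in M \ Mc, ‖h x - ξ x‖) + ∫ x in M \ Mc, ‖ξ x‖ := by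
    rw [← integral_add (hhξ.mono_set hsub).norm (hξi.mono_set hsub).norm]
    refine integral_mono (hhi.mono_set hsub).norm
      ((hhξ.mono_set hsub).norm.add (hξi.mono_set hsub).norm) fun x => ?_
    have := norm_sub_norm_le (h x) (ξ x)
    simp only
    linarith
  have s1 := split _ hhi
  have s2 := split _ hhξ
  have s3 := split _ hξi
  have hsup : eLpNorm h 1 (volume.restrict Mc)
      ≤ eLpNorm h ⊤ (volume.restrict M) * ENNReal.ofReal η := by
    have m : AEStronglyMeasurable h (volume.restrict Mc) := (hhi.mono_set hMcM).1
    have := eLpNorm_le_eLpNorm_mul_rpow_measure_univ (p := 1) (q := ⊤) le_top m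
    simp at this
    refine this.trans (mul_le_mul' ?_ hnoise_size)
    exact eLpNorm_mono_measure _ (Measure.restrict_mono hMcM le_rfl)
  have hb : 2 * (∫ x in Mc, ‖h x‖) ≤ 2 * η * γ (2 * η) * ‖fhat - fdag‖ + ∫ x in M, ‖h x‖ := by
    have hw : 0 ≤ ∫ x in M, ‖h x‖ := by positivity
    rw [key _ _ (hhi.mono_set hMcM)] at hsup
    rcases hη.eq_or_lt with h0 | h0
    · subst h0
      simp only [ENNReal.ofReal_zero, mul_zero, nonpos_iff_eq_zero,
        ENNReal.ofReal_eq_zero] at hsup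
      simp only [mul_zero, zero_mul, zero_add]
      linarith
    · have hs := hsmooth fhat (2 * η) (by positivity) (by linarith)
      have hg := hγnonneg (2 * η) (by positivity) (by linarith)
      have hr : (‖fhat - fdag‖ ^ 2) ^ ((1 : ℝ) / 2) = ‖fhat - fdag‖ := by
        rw [← Real.sqrt_eq_rpow, Real.sqrt_sq (norm_nonneg _)]
      rw [← hh, key _ _ hhi, hr, ← ENNReal.ofReal_mul (by positivity),
        ← ENNReal.ofReal_add (by positivity) (by positivity)] at hs
      have h3 := hsup.trans (mul_le_mul_left hs _)
      rw [← ENNReal.ofReal_mul (by positivity),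
        ENNReal.ofReal_le_ofReal_iff (by positivity)] at h3
      have : (γ (2 * η) * ‖fhat - fdag‖ + 1 / (2 * η) * ∫ x in M, ‖h x‖) * η
        = (2 * η * γ (2 * η) * ‖fhat - fdag‖ + ∫ x in M, ‖h x‖) / 2 := by
        field_simp
      linarith
  have hc : 0 ≤ 2 * η * γ (2 * η) := by
    rcases hη.eq_or_lt with h0 | h0
    · simp [← h0]
    · have := hγnonneg (2 * η) (by positivity) (by linarith)
      positivity
  have htri : ‖fhat - fdag‖ ≤ ‖fhat‖ + ‖fdag‖ := norm_sub_le _ _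
  have hfin : ‖fhat‖ ^ 2 - ‖fdag‖ ^ 2
      ≤ 2 * ε / α + 2 * η * γ (2 * η) / α * (‖fhat‖ + ‖fdag‖) := by
    have h1 := mul_le_mul_of_nonneg_left htri hc
    have h2 : 1 / α * ((∫ x in M, ‖ξ x‖) - ∫ x in M, ‖h x - ξ x‖)
        ≤ 1 / α * (2 * ε + 2 * η * γ (2 * η) * (‖fhat‖ + ‖fdag‖)) :=
      mul_le_mul_of_nonneg_left (by linarith) (by positivity)
    have h3 : 1 / α * (2 * ε + 2 * η * γ (2 * η) * (‖fhat‖ + ‖fdag‖))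
      = 2 * ε / α + 2 * η * γ (2 * η) / α * (‖fhat‖ + ‖fdag‖) := by ring
    linarith
  have hc' : 0 ≤ 2 * η * γ (2 * η) / α := by positivity
  have hs2 : Real.sqrt (2 * ε / α) ^ 2 = 2 * ε / α := Real.sq_sqrt (by positivity)
  have hs0 := Real.sqrt_nonneg (2 * ε / α)
  have ha := norm_nonneg fhat
  have hbn := norm_nonneg fdag
  rw [← hs2] at hfin
  generalize Real.sqrt (2 * ε / α) = s at *
  generalize 2 * η * γ (2 * η) / α = c at *
  generalize ‖fhat‖ = a at *
  generalize ‖fdag‖ = b at *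
  have : a - c / 2 ≤ b + c / 2 + s := by
    refine abs_le_of_sq_le_sq' ?_ (by positivity) |>.2
    nlinarith [mul_nonneg hs0 hbn, mul_nonneg hs0 hc']
  linarith
end

section
/- Let X be a Hilbert space, M a bounded Borel subset of ℝ^d, F : X → L¹(M), f† ∈ X with g† := F(f†). Assume: (i) the smoothing assumption with q = 2 and D(f) := ‖f − f†‖²_X; (ii) F is Lipschitz into L¹, i.e. ‖F(f) − F(f†)‖_{L¹(M)} ≤ C_L‖f − f†‖_X for all f; (iii) f† satisfies the L²-variational source condition: there are β > 0 and a concave nondecreasing φ : [0,∞) → [0,∞) with φ(0) = 0 such that β‖f − f†‖²_X ≤ ‖f‖²_X − ‖f†‖²_X + φ(‖F(f) − F(f†)‖²_{L²(M)}) for all f; (iv) the noise model holds and f̂_α is a Tikhonov estimator with R(f) = ‖f‖²_X and L¹ fidelity, where α is chosen such that √(2ε/α) + 2ηγ(2η)/α ≤ C_e and η ≤ δ₀/2. Then there exists a constant C_v > 0, depending only on δ₀, γ, C_L, ‖f†‖_X and C_e (but not on α, ε, η), such that β‖f̂_α − f†‖²_X ≤ ‖f̂_α‖²_X − ‖f†‖²_X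 + φ(C_v·‖F(f̂_α) − F(f†)‖_{L¹(M)}). -/
open MeasureTheory


theorem aux_split {E : Type*} [MeasurableSpace E] (μ : Measure E) (M Mc : Set E)
    (hMc : MeasurableSet Mc) (hsub : Mc ⊆ M) (f : E → ℝ) :
    eLpNorm f 1 (μ.restrict M)
      = eLpNorm f 1 (μ.restrict Mc) + eLpNorm f 1 (μ.restrict (M \ Mc)) := by
  simp only [eLpNorm_one_eq_lintegral_enorm]
  rw [← lintegral_inter_add_diff (μ := μ) (fun x => ‖f x‖ₑ) M hMc,
    Set.inter_eq_self_of_subset_right hsub]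

theorem aux_L2 {E : Type*} [MeasurableSpace E] (μ : Measure E) (h : E → ℝ)
    (ht : eLpNormEssSup h μ ≠ ⊤) :
    eLpNorm h 2 μ ^ 2 ≤ eLpNorm h ⊤ μ * eLpNorm h 1 μ := by
  have e2 : eLpNorm h 2 μ ^ 2 = ∫⁻ x, ‖h x‖ₑ ^ 2 ∂μ := by
    have := eLpNorm_nnreal_pow_eq_lintegral (f := h) (μ := μ) (p := 2) (by norm_num)
    simpa using this
  rw [e2, eLpNorm_one_eq_lintegral_enorm, eLpNorm_exponent_top]
  calc ∫⁻ x, ‖h x‖ₑ ^ 2 ∂μ ≤ ∫⁻ x, eLpNormEssSup h μ * ‖h x‖ₑ ∂μ := by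
        apply lintegral_mono_ae
        filter_upwards [enorm_ae_le_eLpNormEssSup h μ] with x hx
        rw [sq]; gcongr
    _ ≤ _ := by
        rw [lintegral_const_mul' _ _ ht]

theorem aux_L1 {E : Type*} [MeasurableSpace E] (μ : Measure E) (h : E → ℝ) (M Mc : Set E)
    (hsub : Mc ⊆ M) :
    eLpNorm h 1 (μ.restrict Mc) ≤ eLpNorm h ⊤ (μ.restrict M) * μ Mc := by
  rw [eLpNorm_one_eq_lintegral_enorm]
  have hle : eLpNorm h ⊤ (μ.restrict Mc) ≤ eLpNorm h ⊤ (μ.restrict M) :=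
    eLpNorm_mono_measure _ (Measure.restrict_mono hsub le_rfl)
  calc ∫⁻ x, ‖h x‖ₑ ∂(μ.restrict Mc) ≤ ∫⁻ x, eLpNorm h ⊤ (μ.restrict M) ∂(μ.restrict Mc) := by
        apply lintegral_mono_ae
        filter_upwards [enorm_ae_le_eLpNormEssSup h (μ.restrict Mc)] with x hx
        exact hx.trans (by simpa using hle)
    _ = _ := by simp

/-- Transfer of an `L²`-variational source condition to an `L¹`-variational
source condition at the Tikhonov estimator (Proposition 2.5, part 2): there is a constant
`C_v > 0`, independent of `α`, `ε`, `η` (and of the noise and the estimator), such that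
`β‖f̂_α − f†‖² ≤ ‖f̂_α‖² − ‖f†‖² + φ(C_v‖F(f̂_α) − F(f†)‖_{L¹})`. -/
theorem vsc_transfer_L2_to_L1
    {X : Type*} [NormedAddCommGroup X] [InnerProductSpace ℝ X] [CompleteSpace X]
    {d : ℕ} (M : Set (EuclideanSpace ℝ (Fin d)))
    (hMmeas : MeasurableSet M) (hMbdd : Bornology.IsBounded M)
    (F : X → EuclideanSpace ℝ (Fin d) → ℝ)
    (hFmeas : ∀ f : X, AEStronglyMeasurable (F f) (volume.restrict M))
    -- `F` maps into `L¹(M)`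
    (hFL1 : ∀ f : X, eLpNorm (F f) 1 (volume.restrict M) ≠ ⊤)
    (fdag : X)
    -- (i) smoothing assumption with exponent `q = 2` and `D f = ‖f - f†‖²`
    (δ₀ : ℝ) (hδ₀ : 0 < δ₀) (γ : ℝ → ℝ)
    (hγnonneg : ∀ δ : ℝ, 0 < δ → δ ≤ δ₀ → 0 ≤ γ δ)
    (hγmono : ∀ δ₁ δ₂ : ℝ, 0 < δ₁ → δ₁ ≤ δ₂ → δ₂ ≤ δ₀ → γ δ₁ ≤ γ δ₂)
    (hγlim : Filter.Tendsto γ (nhdsWithin 0 (Set.Ioi 0)) (nhds 0))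
    (hsmooth : ∀ f : X, ∀ δ : ℝ, 0 < δ → δ ≤ δ₀ →
      eLpNorm (fun x => F f x - F fdag x) ⊤ (volume.restrict M)
        ≤ ENNReal.ofReal (γ δ * (‖f - fdag‖ ^ 2) ^ ((1 : ℝ) / 2))
          + ENNReal.ofReal (1 / δ) *
              eLpNorm (fun x => F f x - F fdag x) 1 (volume.restrict M))
    -- (ii) Lipschitz continuity of `F` into `L¹(M)`
    (C_L : ℝ) (hC_L : 0 < C_L)
    (hLip : ∀ f : X,
      eLpNorm (fun x => F f x - F fdag x) 1 (volume.restrict M)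
        ≤ ENNReal.ofReal (C_L * ‖f - fdag‖))
    -- (iii) `L²`-variational source condition at `f†`
    (β : ℝ) (hβ : 0 < β) (φ : ℝ → ℝ)
    (hφconc : ConcaveOn ℝ (Set.Ici 0) φ) (hφmono : MonotoneOn φ (Set.Ici 0))
    (hφ0 : φ 0 = 0)
    (hvsc2 : ∀ f : X,
      β * ‖f - fdag‖ ^ 2 ≤ ‖f‖ ^ 2 - ‖fdag‖ ^ 2
        + φ ((eLpNorm (fun x => F f x - F fdag x) 2 (volume.restrict M)).toReal ^ 2))
    (C_e : ℝ) :
    ∃ C_v : ℝ, 0 < C_v ∧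
      ∀ (ε η : ℝ), 0 ≤ ε → 0 ≤ η → η ≤ δ₀ / 2 →
      ∀ (ξ : EuclideanSpace ℝ (Fin d) → ℝ),
        AEStronglyMeasurable ξ (volume.restrict M) →
        eLpNorm ξ 1 (volume.restrict M) ≠ ⊤ →
      ∀ (gobs : EuclideanSpace ℝ (Fin d) → ℝ), (∀ x, gobs x = F fdag x + ξ x) →
      ∀ (Mc : Set (EuclideanSpace ℝ (Fin d))), MeasurableSet Mc → Mc ⊆ M →
        eLpNorm ξ 1 (volume.restrict (M \ Mc)) ≤ ENNReal.ofReal ε →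
        volume Mc ≤ ENNReal.ofReal η →
      ∀ (α : ℝ), 0 < α →
        -- parameter choice condition
        Real.sqrt (2 * ε / α) + 2 * η * γ (2 * η) / α ≤ C_e →
      ∀ fhat : X,
        (∀ f : X,
          ENNReal.ofReal (1 / α) *
              eLpNorm (fun x => F fhat x - gobs x) 1 (volume.restrict M)
              + ENNReal.ofReal (‖fhat‖ ^ 2)
            ≤ ENNReal.ofReal (1 / α) *
                eLpNorm (fun x => F f x - gobs x) 1 (volume.restrict M)
              + ENNReal.ofReal (‖f‖ ^ 2)) →
        β * ‖fhat - fdag‖ ^ 2 ≤ ‖fhat‖ ^ 2 - ‖fdag‖ ^ 2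
          + φ (C_v *
              (eLpNorm (fun x => F fhat x - F fdag x) 1 (volume.restrict M)).toReal) := by
  have hγ0 := hγnonneg δ₀ hδ₀ le_rfl
  have hK : 0 ≤ 2 * ‖fdag‖ + 2 * |C_e| := by positivity
  have hG : 0 ≤ γ δ₀ + 1 / δ₀ * C_L := by positivity
  refine ⟨(γ δ₀ + 1 / δ₀ * C_L) * (2 * ‖fdag‖ + 2 * |C_e|) + 1, by positivity, ?_⟩
  intro ε η hε hη hηδ ξ hξm hξt gobs hgobs Mc hMc hsub hξε hvol α hα hpar fhat hmin
  have hrt : (‖fhat - fdag‖ ^ 2) ^ ((1 : ℝ) / 2) = ‖fhat - fdag‖ := by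
    rw [← Real.sqrt_eq_rpow, Real.sqrt_sq (norm_nonneg _)]
  have hsm := hsmooth fhat
  rw [hrt] at hsm
  have hLf := hLip fhat
  have hvsc := hvsc2 fhat
  have hhm : AEStronglyMeasurable (fun x => F fhat x - F fdag x) (volume.restrict M) :=
    (hFmeas fhat).sub (hFmeas fdag)
  have hmin' := hmin fdag
  have e1 : (fun x => F fhat x - gobs x)
      = fun x => (F fhat x - F fdag x) - ξ x := by
    funext x; rw [hgobs]; ring
  have e2 : eLpNorm (fun x => F fdag x - gobs x) 1 (volume.restrict M)
      = eLpNorm ξ 1 (volume.restrict M) := by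
    rw [← eLpNorm_neg ξ]
    congr 1; funext x; rw [hgobs]; simp
  rw [e1, e2] at hmin'
  clear e1 e2 hmin hsmooth hLip hvsc2
  set h : EuclideanSpace ℝ (Fin d) → ℝ := fun x => F fhat x - F fdag x with hh
  have hdm : AEStronglyMeasurable (fun x => h x - ξ x) (volume.restrict M) := hhm.sub hξm
  have hLt : eLpNorm h 1 (volume.restrict M) ≠ ⊤ := ne_top_of_le_ne_top ENNReal.ofReal_ne_top hLf
  have hdt : eLpNorm (fun x => h x - ξ x) 1 (volume.restrict M) ≠ ⊤ := by
    refine ne_top_of_le_ne_top (ENNReal.add_ne_top.2 ⟨hLt, hξt⟩)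
      (eLpNorm_sub_le hhm hξm le_rfl)
  have mc : (volume.restrict Mc) ≤ volume.restrict M := Measure.restrict_mono hsub le_rfl
  have md : (volume.restrict (M \ Mc)) ≤ volume.restrict M :=
    Measure.restrict_mono Set.diff_subset le_rfl
  have fin : ∀ (u : EuclideanSpace ℝ (Fin d) → ℝ), eLpNorm u 1 (volume.restrict M) ≠ ⊤ →
      eLpNorm u 1 (volume.restrict Mc) ≠ ⊤ ∧ eLpNorm u 1 (volume.restrict (M \ Mc)) ≠ ⊤ ∧
      (eLpNorm u 1 (volume.restrict M)).toReal = (eLpNorm u 1 (volume.restrict Mc)).toReal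
        + (eLpNorm u 1 (volume.restrict (M \ Mc))).toReal := by
    intro u hu
    have h1 := ne_top_of_le_ne_top hu (eLpNorm_mono_measure u mc)
    have h2 := ne_top_of_le_ne_top hu (eLpNorm_mono_measure u md)
    exact ⟨h1, h2, by rw [aux_split volume M Mc hMc hsub u, ENNReal.toReal_add h1 h2]⟩
  obtain ⟨hhc, hhd, hhs⟩ := fin h hLt
  obtain ⟨hξc, hξd, hξs⟩ := fin ξ hξt
  obtain ⟨hdc, hdd, hds⟩ := fin _ hdt
  -- triangle inequalities
  have t1 : (eLpNorm h 1 (volume.restrict (M \ Mc))).toReal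
      ≤ (eLpNorm (fun x => h x - ξ x) 1 (volume.restrict (M \ Mc))).toReal
        + (eLpNorm ξ 1 (volume.restrict (M \ Mc))).toReal := by
    rw [← ENNReal.toReal_add hdd hξd]
    refine ENNReal.toReal_mono (ENNReal.add_ne_top.2 ⟨hdd, hξd⟩) ?_
    have := eLpNorm_add_le (hdm.mono_measure md) (hξm.mono_measure md) (le_refl 1)
    refine le_trans (le_of_eq ?_) this
    congr 1; funext x; simp
  have t2 : (eLpNorm ξ 1 (volume.restrict Mc)).toReal
      ≤ (eLpNorm h 1 (volume.restrict Mc)).toReal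
        + (eLpNorm (fun x => h x - ξ x) 1 (volume.restrict Mc)).toReal := by
    rw [← ENNReal.toReal_add hhc hdc]
    refine ENNReal.toReal_mono (ENNReal.add_ne_top.2 ⟨hhc, hdc⟩) ?_
    have := eLpNorm_sub_le (hhm.mono_measure mc) (hdm.mono_measure mc) (le_refl 1)
    refine le_trans (le_of_eq ?_) this
    congr 1; funext x; simp
  have t3 : (eLpNorm ξ 1 (volume.restrict (M \ Mc))).toReal ≤ ε :=
    ENNReal.toReal_le_of_le_ofReal hε hξε
  have hsmR : ∀ δ : ℝ, 0 < δ → δ ≤ δ₀ → eLpNorm h ⊤ (volume.restrict M) ≠ ⊤ ∧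
      (eLpNorm h ⊤ (volume.restrict M)).toReal
        ≤ γ δ * ‖fhat - fdag‖ + 1 / δ * (eLpNorm h 1 (volume.restrict M)).toReal := by
    intro δ h0 h1
    have hg := hγnonneg δ h0 h1
    have hs := hsm δ h0 h1
    rw [← ENNReal.ofReal_toReal hLt, ← ENNReal.ofReal_mul (by positivity),
      ← ENNReal.ofReal_add (by positivity) (by positivity)] at hs
    exact ⟨ne_top_of_le_ne_top ENNReal.ofReal_ne_top hs,
      ENNReal.toReal_le_of_le_ofReal (by positivity) hs⟩
  obtain ⟨hSt, hS⟩ := hsmR δ₀ hδ₀ le_rfl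
  have t4 : (eLpNorm h 1 (volume.restrict Mc)).toReal
      ≤ (eLpNorm h ⊤ (volume.restrict M)).toReal * η := by
    have := (aux_L1 volume h M Mc hsub).trans (mul_le_mul_right hvol _)
    have h2 := ENNReal.toReal_mono (ENNReal.mul_ne_top hSt ENNReal.ofReal_ne_top) this
    rwa [ENNReal.toReal_mul, ENNReal.toReal_ofReal hη] at h2
  have hminR : 1 / α * (eLpNorm (fun x => h x - ξ x) 1 (volume.restrict M)).toReal + ‖fhat‖ ^ 2
      ≤ 1 / α * (eLpNorm ξ 1 (volume.restrict M)).toReal + ‖fdag‖ ^ 2 := by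
    rw [← ENNReal.ofReal_toReal hdt, ← ENNReal.ofReal_toReal hξt,
      ← ENNReal.ofReal_mul (by positivity), ← ENNReal.ofReal_mul (by positivity),
      ← ENNReal.ofReal_add (by positivity) (by positivity),
      ← ENNReal.ofReal_add (by positivity) (by positivity)] at hmin'
    exact (ENNReal.ofReal_le_ofReal_iff (by positivity)).1 hmin'
  have t5 : 2 * (eLpNorm h 1 (volume.restrict Mc)).toReal
      ≤ 2 * η * γ (2 * η) * ‖fhat - fdag‖ + (eLpNorm h 1 (volume.restrict M)).toReal := by
    rcases hη.eq_or_lt with h0 | h0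
    · subst h0
      simp only [mul_zero, zero_mul, zero_add] at t4 ⊢
      have : 0 ≤ (eLpNorm h 1 (volume.restrict M)).toReal := ENNReal.toReal_nonneg
      linarith
    · obtain ⟨-, hs⟩ := hsmR (2 * η) (by linarith) (by linarith)
      have h3 := mul_le_mul_of_nonneg_right hs hη
      have h4 : 1 / (2 * η) * (eLpNorm h 1 (volume.restrict M)).toReal * η
        = (eLpNorm h 1 (volume.restrict M)).toReal / 2 := by field_simp
      rw [add_mul, h4] at h3
      linarith
  have hL1R : (eLpNorm h 1 (volume.restrict M)).toReal ≤ C_L * ‖fhat - fdag‖ :=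
    ENNReal.toReal_le_of_le_ofReal (by positivity) hLf
  have hηγ : 0 ≤ 2 * η * γ (2 * η) / α := by
    rcases hη.eq_or_lt with h0 | h0
    · subst h0; simp
    · have := hγnonneg (2 * η) (by linarith) (by linarith)
      positivity
  have hsq0 := Real.sqrt_nonneg (2 * ε / α)
  have hC0 : 0 ≤ C_e := by linarith
  have hεα : 2 * ε / α ≤ C_e ^ 2 := by
    have h1 : Real.sqrt (2 * ε / α) ≤ C_e := by linarith
    exact (Real.sqrt_le_left hC0).1 h1
  have hηγ' : 2 * η * γ (2 * η) / α ≤ C_e := by linarith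
  have key : ‖fhat‖ ^ 2 ≤ ‖fdag‖ ^ 2 + 2 * ε / α
      + 2 * η * γ (2 * η) / α * ‖fhat - fdag‖ := by
    have hd : (eLpNorm ξ 1 (volume.restrict M)).toReal
      - (eLpNorm (fun x => h x - ξ x) 1 (volume.restrict M)).toReal
        ≤ 2 * ε + 2 * η * γ (2 * η) * ‖fhat - fdag‖ := by linarith
    have h5 := mul_le_mul_of_nonneg_left hd (by positivity : 0 ≤ 1 / α)
    have h6 : 1 / α * (2 * ε + 2 * η * γ (2 * η) * ‖fhat - fdag‖)
      = 2 * ε / α + 2 * η * γ (2 * η) / α * ‖fhat - fdag‖ := by ring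
    rw [h6] at h5
    linarith
  have hK' : ‖fhat - fdag‖ ≤ 2 * ‖fdag‖ + 2 * |C_e| := by
    rw [abs_of_nonneg hC0]
    have tri := norm_sub_le fhat fdag
    have hb := norm_nonneg fdag
    have ha := norm_nonneg fhat
    have h7 : 2 * η * γ (2 * η) / α * ‖fhat - fdag‖ ≤ C_e * (‖fhat‖ + ‖fdag‖) :=
      mul_le_mul hηγ' tri (norm_nonneg _) hC0
    have h8 : ‖fhat‖ ≤ ‖fdag‖ + 2 * C_e := by
      by_contra hcon
      push Not at hcon
      nlinarith [mul_nonneg hb hC0]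
    linarith
  have hSfin : (eLpNorm h ⊤ (volume.restrict M)).toReal
      ≤ (γ δ₀ + 1 / δ₀ * C_L) * (2 * ‖fdag‖ + 2 * |C_e|) + 1 := by
    have h9 := mul_le_mul_of_nonneg_left hL1R (by positivity : 0 ≤ 1 / δ₀)
    have h10 := mul_le_mul_of_nonneg_left hK' hG
    linarith
  have hL2 : (eLpNorm h 2 (volume.restrict M)).toReal ^ 2
      ≤ (eLpNorm h ⊤ (volume.restrict M)).toReal * (eLpNorm h 1 (volume.restrict M)).toReal := by
    rw [← ENNReal.toReal_pow, ← ENNReal.toReal_mul]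
    exact ENNReal.toReal_mono (ENNReal.mul_ne_top hSt hLt)
      (aux_L2 _ h (by simpa using hSt))
  have hfin := hL2.trans (mul_le_mul_of_nonneg_right hSfin ENNReal.toReal_nonneg)
  have := hφmono (Set.mem_Ici.2 (by positivity)) (Set.mem_Ici.2 (by positivity)) hfin
  linarith
end

section
/- Let X be a Banach space, M a bounded Borel subset of ℝ^d, F : D(F) ⊆ X → L¹(M), R : X → (−∞,∞] convex and lower semicontinuous, f† ∈ D(F) with g† := F(f†), f* ∈ ∂R(f†) a subgradient, and D the associated Bregman distance. Assume the noise model, let f̂_α be a Tikhonov estimator, and assume the variational source condition (r = 1) and the smoothing assumption with exponent q > 1 both hold at f = f̂_α. Then for every b > 1, setting η₀ := ((b−1)/(2b))·δ₀ and q' := q/(q−1), for all 0 < η ≤ η₀, ε ≥ 0 and α > 0: β·D(f̂_α) ≤ (2q'/α)·ε + β^{1−q'}·((2/α)·η·γ((2b/(b−1))·η))^{q'} + q'·ψ(bα). -/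
open MeasureTheory
open scoped ENNReal


theorem aux_eLpNorm_one {α : Type*} [MeasurableSpace α] {μ : Measure α} {f : α → ℝ}
    (hf : Integrable f μ) : eLpNorm f 1 μ = ENNReal.ofReal (∫ x, |f x| ∂μ) := by
  rw [eLpNorm_one_eq_lintegral_enorm, ← ofReal_integral_norm_eq_lintegral_enorm hf]
  rfl

theorem aux_measure {α : Type*} [MeasurableSpace α] (μ : Measure α) (M Mc : Set α)
    (hMc : MeasurableSet Mc) (hMcM : Mc ⊆ M) (G ξ : α → ℝ)
    (hG : Integrable G (μ.restrict M)) (hξ : Integrable ξ (μ.restrict M))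
    (ε η K : ℝ) (hε : 0 ≤ ε) (hη : 0 ≤ η) (hK : 0 ≤ K)
    (h1 : eLpNorm ξ 1 (μ.restrict (M \ Mc)) ≤ ENNReal.ofReal ε)
    (h2 : μ Mc ≤ ENNReal.ofReal η)
    (h3 : eLpNorm G ⊤ (μ.restrict M) ≤ ENNReal.ofReal K) :
    (∫ x in M, |ξ x| ∂μ) - (∫ x in M, |G x - ξ x| ∂μ)
      ≤ 2 * ε - (∫ x in M, |G x| ∂μ) + 2 * (η * K) := by
  have e1 : ∫ x in M, Mcᶜ.indicator (fun x => |ξ x|) x ∂μ ≤ ε := by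
    rw [integral_indicator hMc.compl, Measure.restrict_restrict hMc.compl]
    have : Mcᶜ ∩ M = M \ Mc := by ext x; simp [and_comm]
    rw [this]
    have hi : Integrable ξ (μ.restrict (M \ Mc)) := 
      hξ.mono_measure (Measure.restrict_mono Set.sdiff_subset le_rfl)
    rw [aux_eLpNorm_one hi] at h1
    exact (ENNReal.ofReal_le_ofReal_iff hε).1 h1
  have e2 : ∫ x in M, Mc.indicator (fun x => |G x|) x ∂μ ≤ η * K := by
    rw [integral_indicator hMc, Measure.restrict_restrict hMc, Set.inter_eq_left.2 hMcM]
    have hae : ∀ᵐ x ∂(μ.restrict M), ‖G x‖ ≤ K := by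
      rw [eLpNorm_exponent_top] at h3
      filter_upwards [ae_le_eLpNormEssSup (f := G) (μ := μ.restrict M)] with x hx
      have := hx.trans h3
      rw [← ofReal_norm] at this
      exact (ENNReal.ofReal_le_ofReal_iff hK).1 this
    have hae2 : ∀ᵐ x ∂(μ.restrict Mc), ‖|G x|‖ ≤ K := by
      filter_upwards [ae_mono (Measure.restrict_mono hMcM le_rfl) hae] with x hx
      simpa using hx
    have hfin : μ Mc < ⊤ := h2.trans_lt ENNReal.ofReal_lt_top
    have : IsFiniteMeasure (μ.restrict Mc) := ⟨by simpa using hfin⟩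
    have := norm_integral_le_of_norm_le_const hae2
    have h4 : (μ.restrict Mc).real Set.univ ≤ η := by
      simp only [Measure.real, Measure.restrict_apply_univ]
      exact ENNReal.toReal_le_of_le_ofReal hη h2
    calc _ ≤ _ := Real.le_norm_self _
      _ ≤ _ := this
      _ ≤ K * η := by gcongr
      _ = _ := mul_comm _ _
  have i1 : Integrable (Mcᶜ.indicator (fun x => |ξ x|)) (μ.restrict M) := hξ.abs.indicator hMc.compl
  have i2 : Integrable (Mc.indicator (fun x => |G x|)) (μ.restrict M) := hG.abs.indicator hMc
  have i3 := hG.abs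
  have i4 := hξ.abs
  have i5 : Integrable (fun x => |G x - ξ x|) (μ.restrict M) := (hG.sub hξ).abs
  have key : ∫ x in M, (|ξ x| - |G x - ξ x|) ∂μ ≤ ∫ x in M,
      ((2 * Mcᶜ.indicator (fun x => |ξ x|) x - |G x|) + 2 * Mc.indicator (fun x => |G x|) x) ∂μ := by
    refine integral_mono (i4.sub i5) (((i1.const_mul 2).sub i3).add (i2.const_mul 2)) ?_
    intro x
    by_cases hx : x ∈ Mc
    · simp [hx]
      have := abs_sub_abs_le_abs_sub (ξ x) (G x)
      rw [abs_sub_comm] at this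
      linarith
    · simp [hx]
      have := abs_sub_abs_le_abs_sub (G x) (ξ x)
      linarith
  have i6 : Integrable (fun x => 2 * Mcᶜ.indicator (fun x => |ξ x|) x - |G x|) (μ.restrict M) :=
    (i1.const_mul 2).sub i3
  rw [integral_sub i4 i5, integral_add i6 (i2.const_mul 2),
    integral_sub (i1.const_mul 2) i3, integral_const_mul, integral_const_mul] at key
  linarith

theorem aux_real (β D q α ε η g n P b Δ : ℝ) (hβ : 0 < β) (hD : 0 ≤ D) (hq : 1 < q) (hα : 0 < α)
    (hη : 0 < η) (hg : 0 ≤ g) (hb : 1 < b)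
    (hvsc : β * D ≤ Δ + P)
    (hm : Δ ≤ 1 / α * (2 * ε - n + 2 * (η * (g * D ^ (1 / q) + 1 / (2 * b / (b - 1) * η) * n)))) :
    β * D ≤ 2 * (q / (q - 1)) / α * ε + β ^ (1 - q / (q - 1)) * (2 / α * η * g) ^ (q / (q - 1))
      + q / (q - 1) * (P - n / (b * α)) := by
  set p := q / (q - 1) with hp
  have hq1 : 0 < q - 1 := by linarith
  have hp0 : 0 < p := by positivity
  have hpq : q.HolderConjugate p := Real.HolderConjugate.conjExponent hq
  set A := 2 / α * η * g with hA
  have hA0 : 0 ≤ A := by positivity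
  have hb1 : b - 1 ≠ 0 := by linarith
  have hm2 : Δ ≤ 2 * ε / α + A * D ^ (1 / q) - n / (b * α) := by
    refine hm.trans (le_of_eq ?_)
    rw [hA]
    field_simp
    ring
  have young := Real.young_inequality_of_nonneg (a := (β * D) ^ (1 / q)) (b := A * β ^ (-(1 / q)))
    (by positivity) (by positivity) hpq
  have y1 : (β * D) ^ (1 / q) * (A * β ^ (-(1 / q))) = A * D ^ (1 / q) := by
    rw [Real.mul_rpow hβ.le hD, Real.rpow_neg hβ.le]
    have : β ^ (1 / q) ≠ 0 := by positivity
    field_simp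
  have y2 : ((β * D) ^ (1 / q)) ^ q = β * D := by
    rw [← Real.rpow_mul (by positivity), one_div_mul_cancel (by linarith), Real.rpow_one]
  have y3 : (A * β ^ (-(1 / q))) ^ p = β ^ (1 - p) * A ^ p := by
    rw [Real.mul_rpow hA0 (by positivity), ← Real.rpow_mul hβ.le, mul_comm]
    congr 2
    rw [hp]; field_simp; ring
  rw [y1, y2, y3] at young
  have h : β * D - β * D / q ≤ 2 * ε / α + β ^ (1 - p) * A ^ p / p + (P - n / (b * α)) := by
    linarith
  have h' := mul_le_mul_of_nonneg_left h hp0.le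
  have l : p * (β * D - β * D / q) = β * D := by
    rw [hp]; field_simp
  have r : p * (2 * ε / α + β ^ (1 - p) * A ^ p / p + (P - n / (b * α))) =
     2 * p / α * ε + β ^ (1 - p) * A ^ p + p * (P - n / (b * α)) := by
    generalize β ^ (1 - p) * A ^ p = Y
    generalize P - n / (b * α) = Z
    field_simp
  linarith

/-- Convergence rate for the Bregman distance of generalized Tikhonov
regularization with `L¹` data fidelity under impulsive noise (Theorem 2.8, estimate (2.10)). -/
theorem tikhonov_bregman_rate
    {X : Type*} [NormedAddCommGroup X] [NormedSpace ℝ X] [CompleteSpace X]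
    {d : ℕ} (M : Set (EuclideanSpace ℝ (Fin d)))
    (hMmeas : MeasurableSet M) (hMbdd : Bornology.IsBounded M)
    (Dom : Set X) (F : X → EuclideanSpace ℝ (Fin d) → ℝ)
    (hFmeas : ∀ f ∈ Dom, AEStronglyMeasurable (F f) (volume.restrict M))
    -- `F` maps `D(F)` into `L¹(M)`
    (hFL1 : ∀ f ∈ Dom, eLpNorm (F f) 1 (volume.restrict M) ≠ ⊤)
    -- the convex, lower semicontinuous penalty `R : X → (-∞,∞]`
    (R : X → EReal) (hRbot : ∀ f, R f ≠ ⊥)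
    (hRconv : ∀ f g : X, ∀ t : ℝ, 0 ≤ t → t ≤ 1 →
      R (t • f + (1 - t) • g) ≤ ((t : ℝ) : EReal) * R f + (((1 - t : ℝ)) : EReal) * R g)
    (hRlsc : LowerSemicontinuous R)
    (fdag : X) (hfdagDom : fdag ∈ Dom) (hRfdag : R fdag ≠ ⊤)
    -- subgradient `f* ∈ ∂R(f†)`
    (fstar : X →L[ℝ] ℝ)
    (hsub : ∀ f : X, R fdag + ((fstar (f - fdag) : ℝ) : EReal) ≤ R f)
    -- index function of the variational source condition
    (β : ℝ) (hβ : 0 < β) (φ : ℝ → ℝ)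
    (hφconc : ConcaveOn ℝ (Set.Ici 0) φ) (hφmono : MonotoneOn φ (Set.Ici 0)) (hφ0 : φ 0 = 0)
    -- data of the smoothing assumption
    (δ₀ : ℝ) (hδ₀ : 0 < δ₀) (q : ℝ) (hq : 1 < q) (γ : ℝ → ℝ)
    (hγnonneg : ∀ δ : ℝ, 0 < δ → δ ≤ δ₀ → 0 ≤ γ δ)
    (hγmono : ∀ δ₁ δ₂ : ℝ, 0 < δ₁ → δ₁ ≤ δ₂ → δ₂ ≤ δ₀ → γ δ₁ ≤ γ δ₂)
    (hγlim : Filter.Tendsto γ (nhdsWithin 0 (Set.Ioi 0)) (nhds 0))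
    -- noise model
    (ξ : EuclideanSpace ℝ (Fin d) → ℝ)
    (hξmeas : AEStronglyMeasurable ξ (volume.restrict M))
    (hξL1 : eLpNorm ξ 1 (volume.restrict M) ≠ ⊤)
    (gobs : EuclideanSpace ℝ (Fin d) → ℝ) (hgobs : ∀ x, gobs x = F fdag x + ξ x)
    (b : ℝ) (hb : 1 < b)
    (ε η : ℝ) (hε : 0 ≤ ε) (hη : 0 < η) (hηη₀ : η ≤ (b - 1) / (2 * b) * δ₀)
    (Mc : Set (EuclideanSpace ℝ (Fin d))) (hMcmeas : MeasurableSet Mc) (hMcM : Mc ⊆ M)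
    (hnoise_out : eLpNorm ξ 1 (volume.restrict (M \ Mc)) ≤ ENNReal.ofReal ε)
    (hnoise_size : volume Mc ≤ ENNReal.ofReal η)
    -- the Tikhonov estimator
    (α : ℝ) (hα : 0 < α) (fhat : X) (hfhatDom : fhat ∈ Dom)
    (hfhat : ∀ f ∈ Dom,
      (((1 / α : ℝ)) : EReal) *
          ((eLpNorm (fun x => F fhat x - gobs x) 1 (volume.restrict M) : ℝ≥0∞) : EReal)
          + R fhat
        ≤ (((1 / α : ℝ)) : EReal) *
            ((eLpNorm (fun x => F f x - gobs x) 1 (volume.restrict M) : ℝ≥0∞) : EReal)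
          + R f)
    -- variational source condition (r = 1), needed only at `f = f̂_α`
    (hvsc : ((β : ℝ) : EReal) * (R fhat - R fdag - ((fstar (fhat - fdag) : ℝ) : EReal))
      ≤ (R fhat - R fdag)
        + ((φ ((eLpNorm (fun x => F fhat x - F fdag x) 1 (volume.restrict M)).toReal) : ℝ) :
            EReal))
    -- smoothing assumption, needed only at `f = f̂_α`
    (hsmooth : ∀ δ : ℝ, 0 < δ → δ ≤ δ₀ →
      eLpNorm (fun x => F fhat x - F fdag x) ⊤ (volume.restrict M)
        ≤ ENNReal.ofReal
            (γ δ * ((R fhat - R fdag - ((fstar (fhat - fdag) : ℝ) : EReal)).toReal) ^ (1 / q))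
          + ENNReal.ofReal (1 / δ) *
              eLpNorm (fun x => F fhat x - F fdag x) 1 (volume.restrict M)) :
    ((β : ℝ) : EReal) * (R fhat - R fdag - ((fstar (fhat - fdag) : ℝ) : EReal))
      ≤ ((2 * (q / (q - 1)) / α * ε : ℝ) : EReal)
        + ((β ^ (1 - q / (q - 1)) *
            ((2 / α) * η * γ ((2 * b / (b - 1)) * η)) ^ (q / (q - 1)) : ℝ) : EReal)
        + ((q / (q - 1) : ℝ) : EReal) *
            ⨆ τ ∈ Set.Ici (0 : ℝ), ((φ τ - τ / (b * α) : ℝ) : EReal) := by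
  have hFi : ∀ f ∈ Dom, Integrable (F f) (volume.restrict M) := fun f hf =>
    memLp_one_iff_integrable.1 ⟨hFmeas f hf, (hFL1 f hf).lt_top⟩
  have hξi : Integrable ξ (volume.restrict M) :=
    memLp_one_iff_integrable.1 ⟨hξmeas, hξL1.lt_top⟩
  have hG : Integrable (fun x => F fhat x - F fdag x) (volume.restrict M) :=
    (hFi _ hfhatDom).sub (hFi _ hfdagDom)
  have hmin := hfhat fdag hfdagDom
  have e1 : (fun x => F fhat x - gobs x) = fun x => (F fhat x - F fdag x) - ξ x := by
    funext x; rw [hgobs]; ring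
  have e2 : (fun x => F fdag x - gobs x) = fun x => - ξ x := by
    funext x; rw [hgobs]; ring
  have j1 : Integrable (fun x => F fhat x - F fdag x - ξ x) (volume.restrict M) := hG.sub hξi
  have j2 : Integrable (fun x => - ξ x) (volume.restrict M) := hξi.neg
  rw [e1, e2, aux_eLpNorm_one j1, aux_eLpNorm_one j2,
    EReal.coe_ennreal_ofReal, EReal.coe_ennreal_ofReal,
    max_eq_left (integral_nonneg fun x => abs_nonneg _),
    max_eq_left (integral_nonneg fun x => abs_nonneg _)] at hmin
  simp only [abs_neg] at hmin
  have hn0 : 0 ≤ ∫ x in M, |F fhat x - F fdag x| := integral_nonneg fun x => abs_nonneg _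
  obtain ⟨r0, hr0⟩ : ∃ r : ℝ, R fdag = r :=
    ⟨(R fdag).toReal, (EReal.coe_toReal hRfdag (hRbot _)).symm⟩
  have hRfhat : R fhat ≠ ⊤ := by
    intro h
    rw [h, hr0, ← EReal.coe_mul, ← EReal.coe_mul, ← EReal.coe_add, EReal.coe_add_top,
      top_le_iff] at hmin
    exact EReal.coe_ne_top _ hmin
  obtain ⟨r1, hr1⟩ : ∃ r : ℝ, R fhat = r :=
    ⟨(R fhat).toReal, (EReal.coe_toReal hRfhat (hRbot _)).symm⟩
  have hs := hsub fhat
  rw [hr0, hr1] at hmin hs hvsc hsmooth ⊢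
  rw [aux_eLpNorm_one hG] at hvsc hsmooth
  rw [ENNReal.toReal_ofReal hn0] at hvsc
  have hb1 : 0 < b - 1 := by linarith
  have hδ : 0 < 2 * b / (b - 1) * η := by positivity
  have hδ' : 2 * b / (b - 1) * η ≤ δ₀ := by
    calc 2 * b / (b - 1) * η ≤ 2 * b / (b - 1) * ((b - 1) / (2 * b) * δ₀) := by gcongr
      _ = δ₀ := by field_simp
  have hsm := hsmooth _ hδ hδ'
  have hg := hγnonneg _ hδ hδ'
  norm_cast at hmin hs hvsc hsm
  have hD : 0 ≤ r1 - r0 - fstar (fhat - fdag) := by linarith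
  rw [EReal.toReal_coe, ← ENNReal.ofReal_mul (by positivity),
    ← ENNReal.ofReal_add (by positivity) (by positivity)] at hsm
  have hm := aux_measure volume M Mc hMcmeas hMcM _ ξ hG hξi ε η _ hε hη.le (by positivity)
    hnoise_out hnoise_size hsm
  have hm' : r1 - r0 ≤ 1 / α * ((∫ x in M, |ξ x|) - ∫ x in M, |F fhat x - F fdag x - ξ x|) := by
    rw [mul_sub]; linarith
  have hfin := aux_real β _ q α ε η _ _ _ b (r1 - r0) hβ hD hq hα hη hg hb hvsc
    (hm'.trans (mul_le_mul_of_nonneg_left hm (by positivity)))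
  have hp0 : (0 : ℝ) ≤ q / (q - 1) := div_nonneg (by linarith) (by linarith)
  have hsup := le_iSup₂ (f := fun (τ : ℝ) (_ : τ ∈ Set.Ici (0 : ℝ)) =>
    ((φ τ - τ / (b * α) : ℝ) : EReal)) _ hn0
  refine le_trans ?_ (add_le_add le_rfl
    (mul_le_mul_of_nonneg_left hsup (EReal.coe_nonneg.2 hp0)))
  exact_mod_cast hfin
end

section
/- For every x ∈ ℝ and every t > 0: Σ_{n∈ℤ} exp(−(n+x)²·t) ≤ Σ_{n∈ℤ} exp(−n²·t) ≤ √(2π)·max{1, t^{−1/2}}. -/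
open scoped Real

lemma gsb_geom (r : ℝ) (h0 : 0 ≤ r) (h1 : r < 1) :
    HasSum (fun n : ℤ => r ^ n.natAbs) ((1 - r)⁻¹ + (1 - r)⁻¹ * r) := by
  apply HasSum.of_nat_of_neg_add_one
  · simpa using hasSum_geometric_of_lt_one h0 h1
  · have h := (hasSum_geometric_of_lt_one h0 h1).mul_right r
    have e : (fun n : ℕ => r ^ (-((n : ℤ) + 1)).natAbs) = fun n : ℕ => r ^ n * r := by
      ext n
      rw [← pow_succ]
      congr 1
    rw [e]
    exact h

lemma gsb_le (c : ℝ) (hc : 0 < c) (n : ℤ) :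
    Real.exp (-((n : ℝ) ^ 2 * c)) ≤ Real.exp (-c) ^ n.natAbs := by
  rw [← Real.exp_nat_mul]
  apply Real.exp_le_exp.2
  have h : (n.natAbs : ℝ) ≤ (n : ℝ) ^ 2 := by
    have h2 : (n.natAbs : ℤ) ≤ n ^ 2 := by
      rw [← Int.natAbs_sq n]
      exact_mod_cast Nat.le_self_pow two_ne_zero _
    have h3 : ((n.natAbs : ℤ) : ℝ) ≤ ((n ^ 2 : ℤ) : ℝ) := Int.cast_le.2 h2
    rw [Int.cast_natCast, Int.cast_pow] at h3
    exact h3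
  nlinarith

lemma gsb_summable (c : ℝ) (hc : 0 < c) :
    Summable (fun n : ℤ => Real.exp (-((n : ℝ) ^ 2 * c))) :=
  Summable.of_nonneg_of_le (fun _ => (Real.exp_pos _).le) (gsb_le c hc)
    (gsb_geom _ (Real.exp_pos _).le (by simpa using hc)).summable

lemma gsb_small (c : ℝ) (hc : 9 ≤ c) :
    ∑' n : ℤ, Real.exp (-((n : ℝ) ^ 2 * c)) ≤ Real.sqrt 2 := by
  have hG := gsb_geom (1 / 10) (by norm_num) (by norm_num)
  have hq : Real.exp (-c) ≤ 1 / 10 := by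
    rw [Real.exp_neg, ← one_div]
    apply one_div_le_one_div_of_le (by norm_num)
    linarith [Real.add_one_le_exp c]
  have h := (gsb_summable c (by linarith)).tsum_le_tsum (fun n =>
    (gsb_le c (by linarith) n).trans (pow_le_pow_left₀ (Real.exp_pos _).le hq _)) hG.summable
  rw [hG.tsum_eq] at h
  refine h.trans (Real.le_sqrt_of_sq_le ?_)
  norm_num

lemma gsb_shift (x t : ℝ) (ht : 0 < t) :
    (∑' n : ℤ, Real.exp (-((n + x) ^ 2 * t))) ≤ (∑' n : ℤ, Real.exp (-((n : ℝ) ^ 2 * t))) := by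
  have hp := Real.pi_pos
  have ha : 0 < π / t := by positivity
  have hac : 0 < ((π / t : ℝ) : ℂ).re := by rwa [Complex.ofReal_re]
  have hpc : (π : ℂ) ≠ 0 := by exact_mod_cast hp.ne'
  have htc : (t : ℂ) ≠ 0 := by exact_mod_cast ht.ne'
  have key : ∀ y : ℝ, (((∑' n : ℤ, Real.exp (-((n + y) ^ 2 * t)) : ℝ)) : ℂ) =
      ((π / t : ℝ) : ℂ) ^ (1 / 2 : ℂ) * ∑' n : ℤ, Complex.exp (-π * ((π / t : ℝ) : ℂ) * n ^ 2
        + 2 * π * (-Complex.I * y) * n) := by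
    intro y
    rw [Complex.tsum_exp_neg_quadratic hac, ← mul_assoc, mul_one_div_cancel, one_mul,
      Complex.ofReal_tsum]
    · congr 1
      ext n
      rw [Complex.ofReal_exp]
      congr 1
      push_cast
      have : Complex.I * (-Complex.I * y) = y := by
        rw [← mul_assoc, mul_neg, Complex.I_mul_I]; simp
      rw [this]
      field_simp
    · rw [Ne, Complex.cpow_eq_zero_iff]
      have : ((π / t : ℝ) : ℂ) ≠ 0 := by exact_mod_cast ha.ne'
      tauto
  have nrm : ∀ (y : ℝ) (n : ℤ), ‖Complex.exp (-π * ((π / t : ℝ) : ℂ) * n ^ 2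
        + 2 * π * (-Complex.I * y) * n)‖ = Real.exp (-((n : ℝ) ^ 2 * (π * (π / t)))) := by
    intro y n
    have : (-π * ((π / t : ℝ) : ℂ) * n ^ 2 + 2 * π * (-Complex.I * y) * n) =
      ((-((n : ℝ) ^ 2 * (π * (π / t))) : ℝ) : ℂ) + ((-2 * π * y * n : ℝ) : ℂ) * Complex.I := by
      push_cast; ring
    rw [this, Complex.exp_add, norm_mul, Complex.norm_exp_ofReal_mul_I, mul_one,
      ← Complex.ofReal_exp, Complex.norm_real, Real.norm_of_nonneg (Real.exp_pos _).le]
  have hs := gsb_summable (π * (π / t)) (by positivity)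
  have k0 : (∑' n : ℤ, Real.exp (-((n : ℝ) ^ 2 * t))) = ‖((π / t : ℝ) : ℂ) ^ (1 / 2 : ℂ)‖ *
      ∑' n : ℤ, Real.exp (-((n : ℝ) ^ 2 * (π * (π / t)))) := by
    have h := congrArg norm (key 0)
    have e : (∑' n : ℤ, Complex.exp (-π * ((π / t : ℝ) : ℂ) * n ^ 2
        + 2 * π * (-Complex.I * (0 : ℝ)) * n)) =
        ((∑' n : ℤ, Real.exp (-((n : ℝ) ^ 2 * (π * (π / t)))) : ℝ) : ℂ) := by
      rw [Complex.ofReal_tsum]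
      congr 1
      ext n
      rw [Complex.ofReal_exp]
      congr 1
      push_cast
      ring
    rw [e, norm_mul, Complex.norm_real, Complex.norm_real,
      Real.norm_of_nonneg (tsum_nonneg fun _ => (Real.exp_pos _).le),
      Real.norm_of_nonneg (tsum_nonneg fun _ => (Real.exp_pos _).le)] at h
    simpa using h
  have h := congrArg norm (key x)
  rw [norm_mul, Complex.norm_real,
      Real.norm_of_nonneg (tsum_nonneg fun _ => (Real.exp_pos _).le)] at h
  rw [h, k0]
  gcongr
  refine (norm_tsum_le_tsum_norm ?_).trans_eq ?_
  · simpa only [nrm] using hs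
  · simp only [nrm]

lemma gsb_le_one (t : ℝ) (ht : 0 < t) (h1 : t ≤ 1) :
    (∑' n : ℤ, Real.exp (-((n : ℝ) ^ 2 * t))) ≤ Real.sqrt (2 * π) * t ^ (-(1 : ℝ) / 2) := by
  have hp := Real.pi_pos
  have h := Real.tsum_exp_neg_mul_int_sq (a := t / π) (by positivity)
  have e1 : ∀ n : ℤ, -π * (t / π) * (n : ℝ) ^ 2 = -((n : ℝ) ^ 2 * t) := by
    intro n; field_simp
  have e2 : ∀ n : ℤ, -π / (t / π) * (n : ℝ) ^ 2 = -((n : ℝ) ^ 2 * (π ^ 2 / t)) := by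
    intro n; field_simp
  simp only [e1, e2] at h
  have h9 : 9 ≤ π ^ 2 / t := by
    rw [le_div_iff₀ ht]
    nlinarith [Real.pi_gt_three]
  have h2 := gsb_small _ h9
  rw [h]
  have e3 : Real.sqrt (2 * π) * t ^ (-(1 : ℝ) / 2) = 1 / (t / π) ^ (1 / 2 : ℝ) * Real.sqrt 2 := by
    rw [neg_div, Real.rpow_neg ht.le, ← Real.sqrt_eq_rpow, ← Real.sqrt_eq_rpow,
      Real.sqrt_div ht.le, Real.sqrt_mul (by norm_num)]
    field_simp
  rw [e3]
  gcongr

/-- Gaussian summation bound: for every `x ∈ ℝ` and `t > 0`,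
`Σ_{n∈ℤ} exp(-(n+x)² t) ≤ Σ_{n∈ℤ} exp(-n² t) ≤ √(2π) · max {1, t^{-1/2}}`. -/
theorem gaussian_sum_bound (x t : ℝ) (ht : 0 < t) :
    (∑' n : ℤ, Real.exp (-((n + x) ^ 2 * t))) ≤ (∑' n : ℤ, Real.exp (-((n : ℝ) ^ 2 * t))) ∧
    (∑' n : ℤ, Real.exp (-((n : ℝ) ^ 2 * t)))
      ≤ Real.sqrt (2 * π) * max 1 (t ^ (-(1 : ℝ) / 2)) := by
  refine ⟨gsb_shift x t ht, ?_⟩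
  rcases le_total t 1 with h | h
  · exact (gsb_le_one t ht h).trans (by gcongr; exact le_max_right _ _)
  · have h1 := gsb_le_one 1 one_pos le_rfl
    rw [Real.one_rpow] at h1
    refine le_trans ?_ (h1.trans (by gcongr; exact le_max_left _ _))
    refine (gsb_summable t ht).tsum_le_tsum (fun n => ?_) (gsb_summable 1 one_pos)
    apply Real.exp_le_exp.2
    nlinarith [sq_nonneg (n : ℝ)]
end

section
/- Let R > 1 and define λ(r) := −4·ln(R − exp(r)) for 0 ≤ r < ln(R) and λ(r) := ∞ for r ≥ ln(R). Then for every s ≥ 4/(R−1), the Fenchel conjugate λ*(s) := sup_{r≥0}(s·r − λ(r)) satisfies exp(−λ*(s)) = ((4+s)/(4R))⁴·((4+s)/(sR))^s. Moreover there is an absolute constant C > 0 (independent of R and s) such that exp(−λ*(s)) ≤ C·s⁴·R^{−s−4} for all s ≥ max{1, 4/(R−1)}. -/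
/-- The quantity `exp (-λ*(s))`, where `λ*(s) = sup_{r ≥ 0} (s r - λ(r))` is the Fenchel
conjugate of `λ` (with the convention `exp (-∞) = 0`). -/
noncomputable def expNegLamStar (lam : ℝ → EReal) (s : ℝ) : ℝ :=
  sInf {y : ℝ | ∃ r : ℝ, 0 ≤ r ∧ lam r ≠ ⊤ ∧ y = Real.exp ((lam r).toReal - s * r)}

/-- The weight function `λ(r) = -4 ln(R - eʳ)` for `0 ≤ r < ln R`, `λ(r) = ∞` otherwise,
arising in the satellite gradiometry problem. -/
noncomputable def gradLam (R : ℝ) : ℝ → EReal := fun r =>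
  if 0 ≤ r ∧ r < Real.log R then ((-4 * Real.log (R - Real.exp r) : ℝ) : EReal) else ⊤

theorem grad_formula_aux (R : ℝ) (hR : 1 < R) (s : ℝ) (hs : 4 / (R - 1) ≤ s) :
    expNegLamStar (gradLam R) s
      = ((4 + s) / (4 * R)) ^ (4 : ℕ) * ((4 + s) / (s * R)) ^ s := by
  have hR1 : 0 < R - 1 := by linarith
  have hs0 : 0 < s := lt_of_lt_of_le (by positivity) hs
  have hR0 : 0 < R := by linarith
  have h4 : 4 ≤ s * (R - 1) := (div_le_iff₀ hR1).1 hs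
  have ha : 0 < 4 * R / (4 + s) := by positivity
  have hx : 0 < s * R / (4 + s) := by positivity
  have hform : ((4 + s) / (4 * R)) ^ (4 : ℕ) * ((4 + s) / (s * R)) ^ s
      = Real.exp (-4 * Real.log (4 * R / (4 + s)) - s * Real.log (s * R / (4 + s))) := by
    have e1 : (4 + s) / (4 * R) = Real.exp (-Real.log (4 * R / (4 + s))) := by
      rw [Real.exp_neg, Real.exp_log ha, inv_div]
    have e2 : (4 + s) / (s * R) = Real.exp (-Real.log (s * R / (4 + s))) := by
      rw [Real.exp_neg, Real.exp_log hx, inv_div]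
    rw [e1, e2, ← Real.exp_mul, ← Real.exp_nat_mul, ← Real.exp_add]
    congr 1
    push_cast
    ring
  rw [hform]
  apply IsLeast.csInf_eq
  constructor
  · have h1 : 0 ≤ Real.log (s * R / (4 + s)) := by
      apply Real.log_nonneg
      rw [le_div_iff₀ (by positivity)]
      linarith
    have h2 : Real.log (s * R / (4 + s)) < Real.log R := by
      apply Real.log_lt_log hx
      rw [div_lt_iff₀ (by positivity)]
      nlinarith
    have h3 : R - s * R / (4 + s) = 4 * R / (4 + s) := by
      field_simp
      ring
    refine ⟨Real.log (s * R / (4 + s)), h1, ?_, ?_⟩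
    · simp only [gradLam, if_pos (And.intro h1 h2)]
      exact EReal.coe_ne_top _
    · simp only [gradLam, if_pos (And.intro h1 h2)]
      rw [EReal.toReal_coe, Real.exp_log hx, h3]
  · rintro y ⟨r, hr, htop, rfl⟩
    by_cases h : 0 ≤ r ∧ r < Real.log R
    · simp only [gradLam, if_pos h]
      rw [EReal.toReal_coe, Real.exp_le_exp]
      have hlt : Real.exp r < R := (Real.lt_log_iff_exp_lt hR0).1 h.2
      have hp : 0 < R - Real.exp r := by linarith
      have i1 := Real.log_le_sub_one_of_pos (div_pos hp ha)
      have i2 := Real.log_le_sub_one_of_pos (div_pos (Real.exp_pos r) hx)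
      rw [Real.log_div hp.ne' ha.ne'] at i1
      rw [Real.log_div (Real.exp_pos r).ne' hx.ne', Real.log_exp] at i2
      have i3 := mul_le_mul_of_nonneg_left i2 hs0.le
      have key : 4 * ((R - Real.exp r) / (4 * R / (4 + s)) - 1)
          + s * (Real.exp r / (s * R / (4 + s)) - 1) = 0 := by
        field_simp
        ring
      linarith
    · exact absurd (by simp only [gradLam, if_neg h]) htop

/-- Explicit computation and estimate of the Fenchel conjugate of the
gradiometry weight function (proof of Lemma 4.3, part 2):
`exp(-λ*(s)) = ((4+s)/(4R))⁴ ((4+s)/(sR))^s` for `s ≥ 4/(R-1)`, and there is an absolute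
constant `C > 0` with `exp(-λ*(s)) ≤ C s⁴ R^{-s-4}` for all `s ≥ max{1, 4/(R-1)}`. -/
theorem gradiometry_conjugate_weight :
    (∀ R : ℝ, 1 < R → ∀ s : ℝ, 4 / (R - 1) ≤ s →
      expNegLamStar (gradLam R) s
        = ((4 + s) / (4 * R)) ^ (4 : ℕ) * ((4 + s) / (s * R)) ^ s) ∧
    ∃ C : ℝ, 0 < C ∧
      ∀ R : ℝ, 1 < R → ∀ s : ℝ, max 1 (4 / (R - 1)) ≤ s →
        expNegLamStar (gradLam R) s ≤ C * s ^ (4 : ℕ) * R ^ (-s - 4) := by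
  refine ⟨grad_formula_aux, (5 / 4) ^ 4 * Real.exp 4, by positivity, ?_⟩
  intro R hR s hs
  have hs1 : 1 ≤ s := (le_max_left _ _).trans hs
  have hs0 : 0 < s := by linarith
  have hR0 : 0 < R := by linarith
  rw [grad_formula_aux R hR s ((le_max_right _ _).trans hs)]
  have e1 : R ^ (-s - 4) = (R ^ (4 : ℕ))⁻¹ * (R ^ s)⁻¹ := by
    rw [Real.rpow_sub hR0, Real.rpow_neg hR0.le]
    norm_cast
    rw [div_eq_mul_inv, mul_comm]
  have e2 : ((4 + s) / (s * R)) ^ s = (1 + 4 / s) ^ s * (R ^ s)⁻¹ := by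
    rw [← div_eq_mul_inv, ← Real.div_rpow (by positivity) hR0.le]
    congr 1
    field_simp
    ring
  have e3 : (1 + 4 / s) ^ s ≤ Real.exp 4 := by
    have := Real.rpow_le_rpow (by positivity) (Real.add_one_le_exp (4 / s)) hs0.le
    rw [← Real.exp_mul, div_mul_cancel₀ _ hs0.ne'] at this
    rwa [add_comm]
  have e4 : ((4 + s) / (4 * R)) ^ (4 : ℕ) ≤ (5 / 4) ^ 4 * s ^ 4 * (R ^ 4)⁻¹ := by
    rw [← mul_pow, ← inv_pow, ← mul_pow]
    apply pow_le_pow_left₀ (by positivity)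
    rw [← div_eq_mul_inv, div_le_div_iff₀ (by positivity) hR0]
    nlinarith
  rw [e1, e2]
  calc _ ≤ ((5 / 4) ^ 4 * s ^ 4 * (R ^ 4)⁻¹) * (Real.exp 4 * (R ^ s)⁻¹) := by
        gcongr
    _ = _ := by ring
end
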